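/- Let (A, L) be a random financial network and c ≥ 0. Then the infimum defining the inner risk ρ^I_c(A, L) = inf_{Y ∈ 𝒞^c} η(Λ(A+Y, L)) is attained: there exists Y ∈ 𝒞^c with η(Λ(A+Y, L)) = ρ^I_c(A, L). -/

import Mathlib

open MeasureTheory

/-- Total liability vector: `ℓ̄_i = ∑_j ℓ_{ij}`. -/
noncomputable def lbar {N : ℕ} (ℓ : Fin N → Fin N → ℝ) : Fin N → ℝ := fun i => ∑ j, ℓ i j

/-- Relative liability matrix: `π_{ij} = ℓ_{ij}/ℓ̄_i` if `ℓ̄_i > 0`, else `0`. -/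
noncomputable def relPi {N : ℕ} (ℓ : Fin N → Fin N → ℝ) : Fin N → Fin N → ℝ :=
  fun i j => if 0 < lbar ℓ i then ℓ i j / lbar ℓ i else 0

/-- The Eisenberg–Noe clearing map `Φ(p, a, π, ℓ̄) = (πᵀp + a) ∧ ℓ̄`. -/
noncomputable def Phi {N : ℕ} (π : Fin N → Fin N → ℝ) (a lb p : Fin N → ℝ) : Fin N → ℝ :=
  fun i => min ((∑ j, π j i * p j) + a i) (lb i)

/-- The clearing vector `CV(a, ℓ)`: the (for `a ∈ ℝ^N_{++}` unique) nonnegative fixed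
point of the clearing map associated with the liability matrix `ℓ`. -/
noncomputable def clearingVec {N : ℕ} (a : Fin N → ℝ) (ℓ : Fin N → Fin N → ℝ) : Fin N → ℝ :=
  Classical.epsilon fun p => (∀ i, 0 ≤ p i) ∧ Phi (relPi ℓ) a (lbar ℓ) p = p

/-- The Eisenberg–Noe aggregation function `Λ(a, ℓ) = ∑_i (ℓ̄_i − CV_i(a, ℓ))`. -/
noncomputable def aggLoss {N : ℕ} (a : Fin N → ℝ) (ℓ : Fin N → Fin N → ℝ) : ℝ :=
  ∑ i, (lbar ℓ i - clearingVec a ℓ i)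

/-- The feasible total bailout-capital levels: constants `c` such that some admissible
random allocation `Y ∈ 𝒞` with `∑ᵢ Yᵢ = c` a.s. makes the system acceptable. -/
noncomputable def feas {Ω : Type*} [MeasurableSpace Ω] (P : Measure Ω) {N : ℕ}
    (η : (Ω → ℝ) → ℝ) (A : Ω → Fin N → ℝ) (L : Ω → Fin N → Fin N → ℝ) (b : ℝ) : Set ℝ :=
  {c : ℝ | ∃ Y : Ω → Fin N → ℝ, Measurable Y ∧ (∀ ω i, 0 ≤ Y ω i) ∧
    (∀ᵐ ω ∂P, ∑ i, Y ω i = c) ∧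
    η (fun ω => aggLoss (fun i => A ω i + Y ω i) (L ω)) ≤ b}

/-- The systemic risk measure `ρ_b(A, L)`. -/
noncomputable def sysRisk {Ω : Type*} [MeasurableSpace Ω] (P : Measure Ω) {N : ℕ}
    (η : (Ω → ℝ) → ℝ) (A : Ω → Fin N → ℝ) (L : Ω → Fin N → Fin N → ℝ) (b : ℝ) : ℝ :=
  sInf (feas P η A L b)

/-- The inner risk `ρ^I_c(A, L) = inf_{Y ∈ 𝒞^c} η(Λ(A+Y, L))`. -/
noncomputable def innerRisk {Ω : Type*} [MeasurableSpace Ω] (P : Measure Ω) {N : ℕ}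
    (η : (Ω → ℝ) → ℝ) (A : Ω → Fin N → ℝ) (L : Ω → Fin N → Fin N → ℝ) (c : ℝ) : ℝ :=
  sInf {r : ℝ | ∃ Y : Ω → Fin N → ℝ, Measurable Y ∧ (∀ ω i, 0 ≤ Y ω i) ∧
    (∀ᵐ ω ∂P, ∑ i, Y ω i = c) ∧
    r = η (fun ω => aggLoss (fun i => A ω i + Y ω i) (L ω))}

open Filter Topology Set

/-- A Carathéodory function attains its minimum over a compact metric space along a
measurable selection. -/
theorem exists_measurable_argmin {Ω E : Type*} [MeasurableSpace Ω] [MetricSpace E]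
    [CompactSpace E] [Nonempty E] [MeasurableSpace E] [BorelSpace E] (f : Ω → E → ℝ)
    (hmeas : ∀ y, Measurable fun ω => f ω y) (hcont : ∀ ω, Continuous (f ω)) :
    ∃ Y : Ω → E, Measurable Y ∧ ∀ ω y, f ω (Y ω) ≤ f ω y := by
  obtain ⟨ψ, hψ, hψs⟩ := exists_nat_bool_continuous_surjective_of_compact E
  obtain ⟨φ, hφ, hφs⟩ : ∃ φ : cantorSet → E, Continuous φ ∧ φ.Surjective :=
    ⟨ψ ∘ cantorSetHomeomorphNatToBool, hψ.comp cantorSetHomeomorphNatToBool.continuous,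
      hψs.comp cantorSetHomeomorphNatToBool.surjective⟩
  have : CompactSpace cantorSet := isCompact_iff_compactSpace.mp isCompact_cantorSet
  have : Nonempty cantorSet := ⟨⟨0, zero_mem_cantorSet⟩⟩
  have hc : ∀ ω, Continuous fun t => f ω (φ t) := fun ω => (hcont ω).comp hφ
  have hleast : ∀ ω, ∃ t : cantorSet, (∀ u, f ω (φ t) ≤ f ω (φ u)) ∧
      ∀ s : cantorSet, (∀ u, f ω (φ s) ≤ f ω (φ u)) → (t : ℝ) ≤ s := by
    intro ω
    have hcl : IsClosed {t : cantorSet | ∀ u, f ω (φ t) ≤ f ω (φ u)} := by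
      simp only [ofPred_forall]
      exact isClosed_iInter fun u => isClosed_le (hc ω) continuous_const
    have hne : {t : cantorSet | ∀ u, f ω (φ t) ≤ f ω (φ u)}.Nonempty := by
      obtain ⟨t, -, ht⟩ := isCompact_univ.exists_isMinOn univ_nonempty (hc ω).continuousOn
      exact ⟨t, fun u => ht (mem_univ u)⟩
    obtain ⟨t, ht, hmin⟩ :=
      hcl.isCompact.exists_isMinOn hne (continuous_subtype_val (p := (· ∈ cantorSet))).continuousOn
    exact ⟨t, ht, fun s hs => hmin hs⟩
  choose t ht htmin using hleast
  suffices htm : Measurable t from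
    ⟨fun ω => φ (t ω), hφ.measurable.comp htm, fun ω y => by
      obtain ⟨u, rfl⟩ := hφs y
      exact ht ω u⟩
  suffices htm : Measurable fun ω => (t ω : ℝ) from htm.subtype_mk (h := fun ω => (t ω).2)
  refine measurable_of_Iic fun s => ?_
  let S : Set cantorSet := {v | (v : ℝ) ≤ s}
  have hS : IsCompact S := (isClosed_le continuous_subtype_val continuous_const).isCompact
  obtain ⟨D, hDS, hDc, hDd⟩ :=
    (TopologicalSpace.IsSeparable.of_separableSpace S).exists_countable_dense_subset
  obtain ⟨D', hD'c, hD'd⟩ := TopologicalSpace.exists_countable_dense cantorSet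
  have key : (fun ω => (t ω : ℝ)) ⁻¹' Iic s =
      ⋂ u ∈ D', ⋂ n : ℕ, ⋃ v ∈ D, {ω | f ω (φ v) < f ω (φ u) + 1 / ((n : ℝ) + 1)} := by
    ext ω
    simp only [mem_preimage, mem_Iic, mem_iInter, mem_iUnion, mem_ofPred_eq, exists_prop]
    constructor
    · intro hs u _ n
      have hlt : f ω (φ (t ω)) < f ω (φ u) + 1 / ((n : ℝ) + 1) :=
        (ht ω u).trans_lt (lt_add_of_pos_right _ Nat.one_div_pos_of_nat)
      obtain ⟨v, hv, hvD⟩ := mem_closure_iff.mp (hDd hs) _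
        (isOpen_lt (hc ω) continuous_const) hlt
      exact ⟨v, hvD, hv⟩
    · intro h
      obtain ⟨u₀, hu₀⟩ := hD'd.nonempty
      obtain ⟨v₀, hv₀, -⟩ := h u₀ hu₀ 0
      obtain ⟨v, hvS, hv⟩ := hS.exists_isMinOn ⟨v₀, hDS hv₀⟩ (hc ω).continuousOn
      have hle : ∀ u ∈ D', f ω (φ v) ≤ f ω (φ u) := by
        intro u hu
        refine le_of_forall_pos_lt_add fun ε hε => ?_
        obtain ⟨n, hn⟩ := exists_nat_one_div_lt hε
        obtain ⟨w, hw, hwlt⟩ := h u hu n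
        have : f ω (φ v) ≤ f ω (φ w) := hv (hDS hw)
        linarith
      have hcl : IsClosed {u | f ω (φ v) ≤ f ω (φ u)} := isClosed_le continuous_const (hc ω)
      have hall : ∀ u, f ω (φ v) ≤ f ω (φ u) := fun u =>
        hcl.closure_subset_iff.mpr hle (hD'd u)
      exact (htmin ω v hall).trans hvS
  rw [key]
  exact .biInter hD'c fun u _ => .iInter fun n => .biUnion hDc fun v _ =>
    measurableSet_lt (hmeas _) ((hmeas _).add_const _)

section Clearing

variable {N : ℕ}

theorem lbar_nonneg {ℓ : Fin N → Fin N → ℝ} (hℓ : ∀ i j, 0 ≤ ℓ i j) (i : Fin N) :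
    0 ≤ lbar ℓ i :=
  Finset.sum_nonneg fun j _ => hℓ i j

theorem relPi_nonneg {ℓ : Fin N → Fin N → ℝ} (hℓ : ∀ i j, 0 ≤ ℓ i j) (i j : Fin N) :
    0 ≤ relPi ℓ i j := by
  unfold relPi
  split_ifs with h
  · exact div_nonneg (hℓ i j) h.le
  · exact le_rfl

theorem Phi_monotone {π : Fin N → Fin N → ℝ} (hπ : ∀ i j, 0 ≤ π i j) (a lb : Fin N → ℝ) :
    Monotone (Phi π a lb) := fun _ _ hpq _ =>
  min_le_min_right _ <| add_le_add_left
    (Finset.sum_le_sum fun j _ => mul_le_mul_of_nonneg_left (hpq j) (hπ j _)) _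

theorem continuous_Phi (π : Fin N → Fin N → ℝ) (lb : Fin N → ℝ) :
    Continuous fun x : (Fin N → ℝ) × (Fin N → ℝ) => Phi π x.1 lb x.2 := by
  unfold Phi
  fun_prop

theorem continuous_iterate_Phi (π : Fin N → Fin N → ℝ) (lb : Fin N → ℝ) (n : ℕ) :
    Continuous fun a => (Phi π a lb)^[n] 0 := by
  induction n with
  | zero => exact continuous_const
  | succ n ih =>
    simp only [Function.iterate_succ_apply']
    exact (continuous_Phi π lb).comp (continuous_id.prodMk ih)

theorem measurable_iterate_Phi {Ω : Type*} [MeasurableSpace Ω] {a : Ω → Fin N → ℝ}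
    {ℓ : Ω → Fin N → Fin N → ℝ} (ha : Measurable a) (hℓ : Measurable ℓ) (n : ℕ) :
    Measurable fun ω => (Phi (relPi (ℓ ω)) (a ω) (lbar (ℓ ω)))^[n] 0 := by
  have hℓij : ∀ i j, Measurable fun ω => ℓ ω i j := fun i j => by fun_prop
  have hlb : ∀ i, Measurable fun ω => lbar (ℓ ω) i := fun i =>
    Finset.measurable_sum _ fun j _ => hℓij i j
  have hπ : ∀ i j, Measurable fun ω => relPi (ℓ ω) i j := fun i j =>
    Measurable.ite (measurableSet_lt measurable_const (hlb i)) ((hℓij i j).div (hlb i))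
      measurable_const
  induction n with
  | zero => exact measurable_const
  | succ n ih =>
    simp only [Function.iterate_succ_apply']
    refine measurable_pi_lambda _ fun i => ?_
    refine Measurable.min (Measurable.add ?_ (by fun_prop)) (hlb i)
    exact Finset.measurable_sum _ fun j _ => (hπ j i).mul ((measurable_pi_apply j).comp ih)

/-- Iterating the clearing map from any nonnegative vector exceeds the geometric lower bound
`(1 - (1 - κ)^n) p` for every fixed point `p`. -/
theorem le_iterate_Phi {π : Fin N → Fin N → ℝ} (hπ : ∀ i j, 0 ≤ π i j) {a lb p q : Fin N → ℝ}
    {κ : ℝ} (hκ0 : 0 ≤ κ) (hκ1 : κ ≤ 1) (hκ : ∀ i, κ * lb i ≤ a i)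
    (hp0 : ∀ i, 0 ≤ p i) (hp : Phi π a lb p = p) (hq0 : ∀ i, 0 ≤ q i) (n : ℕ) (i : Fin N) :
    (1 - (1 - κ) ^ n) * p i ≤ (Phi π a lb)^[n] q i := by
  induction n generalizing i with
  | zero => simpa using hq0 i
  | succ n ih =>
    rw [Function.iterate_succ_apply']
    have hr0 : 0 ≤ (1 - κ) ^ n := pow_nonneg (by linarith) n
    have hr1 : (1 - κ) ^ n ≤ 1 := pow_le_one₀ (by linarith) (by linarith)
    have hpi : p i = min ((∑ j, π j i * p j) + a i) (lb i) := (congrFun hp i).symm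
    have hps : p i ≤ (∑ j, π j i * p j) + a i := hpi.le.trans (min_le_left _ _)
    have hpl : p i ≤ lb i := hpi.le.trans (min_le_right _ _)
    have hκp : κ * p i ≤ a i := (mul_le_mul_of_nonneg_left hpl hκ0).trans (hκ i)
    rw [pow_succ]
    generalize (1 - κ) ^ n = r at *
    refine le_min ?_ ?_
    · have hsum : (1 - r) * ∑ j, π j i * p j ≤ ∑ j, π j i * (Phi π a lb)^[n] q j := by
        rw [Finset.mul_sum]
        refine Finset.sum_le_sum fun j _ => ?_
        calc (1 - r) * (π j i * p j) = π j i * ((1 - r) * p j) := by ring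
          _ ≤ _ := mul_le_mul_of_nonneg_left (ih j) (hπ j i)
      have h1 := mul_le_mul_of_nonneg_left hps (sub_nonneg.mpr hr1)
      have h2 := mul_le_mul_of_nonneg_left hκp hr0
      linarith
    · have : 0 ≤ r * (1 - κ) * p i := mul_nonneg (mul_nonneg hr0 (by linarith)) (hp0 i)
      linarith

theorem iterate_Phi_zero_le {π : Fin N → Fin N → ℝ} (hπ : ∀ i j, 0 ≤ π i j)
    {a lb p : Fin N → ℝ} (hp0 : ∀ i, 0 ≤ p i) (hp : Phi π a lb p = p) (n : ℕ) :
    (Phi π a lb)^[n] 0 ≤ p :=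
  ((Phi_monotone hπ a lb).iterate n hp0).trans_eq (Function.iterate_fixed hp n)

theorem exists_Phi_fixed {π : Fin N → Fin N → ℝ} (hπ : ∀ i j, 0 ≤ π i j) {a lb : Fin N → ℝ}
    (ha : ∀ i, 0 ≤ a i) (hlb : ∀ i, 0 ≤ lb i) :
    ∃ p : Fin N → ℝ, (∀ i, 0 ≤ p i) ∧ Phi π a lb p = p := by
  have hzero : (0 : Fin N → ℝ) ≤ Phi π a lb 0 := fun i => by
    simpa [Phi] using ⟨ha i, hlb i⟩
  have hmono : Monotone fun n => (Phi π a lb)^[n] 0 :=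
    (Phi_monotone hπ a lb).monotone_iterate_of_le_map hzero
  have hbdd : ∀ n, (Phi π a lb)^[n] 0 ≤ lb := by
    intro n
    cases n with
    | zero => exact hlb
    | succ n =>
      rw [Function.iterate_succ_apply']
      exact fun i => min_le_right _ _
  have hlim : Tendsto (fun n => (Phi π a lb)^[n] 0) atTop
      (𝓝 fun i => ⨆ n, (Phi π a lb)^[n] 0 i) :=
    tendsto_pi_nhds.mpr fun i => tendsto_atTop_ciSup (fun _ _ h => hmono h i)
      ⟨lb i, forall_mem_range.mpr fun n => hbdd n i⟩
  refine ⟨_, fun i => ge_of_tendsto' (tendsto_pi_nhds.mp hlim i) fun n => hmono n.zero_le i, ?_⟩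
  exact isFixedPt_of_tendsto_iterate hlim
    ((continuous_Phi π lb).comp (continuous_const.prodMk continuous_id)).continuousAt

variable {a : Fin N → ℝ} {ℓ : Fin N → Fin N → ℝ}

theorem clearingVec_spec (ha : ∀ i, 0 ≤ a i) (hℓ : ∀ i j, 0 ≤ ℓ i j) :
    (∀ i, 0 ≤ clearingVec a ℓ i) ∧
      Phi (relPi ℓ) a (lbar ℓ) (clearingVec a ℓ) = clearingVec a ℓ :=
  Classical.epsilon_spec (exists_Phi_fixed (relPi_nonneg hℓ) ha (lbar_nonneg hℓ))

theorem clearingVec_le_lbar (ha : ∀ i, 0 ≤ a i) (hℓ : ∀ i j, 0 ≤ ℓ i j) (i : Fin N) :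
    clearingVec a ℓ i ≤ lbar ℓ i :=
  (congrFun (clearingVec_spec ha hℓ).2 i).symm.trans_le (min_le_right _ _)

theorem aggLoss_nonneg (ha : ∀ i, 0 ≤ a i) (hℓ : ∀ i j, 0 ≤ ℓ i j) : 0 ≤ aggLoss a ℓ :=
  Finset.sum_nonneg fun i _ => sub_nonneg.mpr (clearingVec_le_lbar ha hℓ i)

theorem aggLoss_le (ha : ∀ i, 0 ≤ a i) (hℓ : ∀ i j, 0 ≤ ℓ i j) :
    aggLoss a ℓ ≤ ∑ i, ∑ j, ℓ i j :=
  Finset.sum_le_sum fun i _ => sub_le_self _ ((clearingVec_spec ha hℓ).1 i)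

theorem exists_contraction_rate (a lb : Fin N → ℝ) (ha : ∀ i, 0 < a i) :
    ∃ κ : ℝ, 0 < κ ∧ κ ≤ 1 ∧ ∀ i, κ * lb i ≤ a i := by
  have h : ∀ i, ∀ᶠ κ : ℝ in 𝓝[>] 0, κ * lb i ≤ a i := fun i => by
    have : Tendsto (fun κ : ℝ => κ * lb i) (𝓝[>] 0) (𝓝 0) :=
      ((continuous_mul_const (lb i)).tendsto' 0 0 (zero_mul _)).mono_left nhdsWithin_le_nhds
    exact (this.eventually_lt_const (ha i)).mono fun _ => le_of_lt
  obtain ⟨κ, hκ, hκ0, hκ1⟩ := ((eventually_all.mpr h).and (Ioo_mem_nhdsGT one_pos)).exists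
  exact ⟨κ, hκ0, hκ1.le, hκ⟩

theorem abs_clearingVec_sub_iterate_le (ha : ∀ i, 0 ≤ a i) (hℓ : ∀ i j, 0 ≤ ℓ i j) {κ : ℝ}
    (hκ0 : 0 ≤ κ) (hκ1 : κ ≤ 1) (hκ : ∀ i, κ * lbar ℓ i ≤ a i) (n : ℕ) (i : Fin N) :
    |clearingVec a ℓ i - (Phi (relPi ℓ) a (lbar ℓ))^[n] 0 i| ≤ (1 - κ) ^ n * lbar ℓ i := by
  obtain ⟨hp0, hp⟩ := clearingVec_spec ha hℓ
  have hlow := le_iterate_Phi (relPi_nonneg hℓ) hκ0 hκ1 hκ hp0 hp (q := 0) (fun _ => le_rfl) n i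
  have hup := iterate_Phi_zero_le (relPi_nonneg hℓ) hp0 hp n i
  have hl := mul_le_mul_of_nonneg_left (clearingVec_le_lbar ha hℓ i)
    (pow_nonneg (sub_nonneg.mpr hκ1) n)
  rw [abs_of_nonneg (sub_nonneg.mpr hup)]
  linarith

theorem tendsto_pow_mul_zero {κ : ℝ} (hκ0 : 0 < κ) (hκ1 : κ ≤ 1) (b : ℝ) :
    Tendsto (fun n : ℕ => (1 - κ) ^ n * b) atTop (𝓝 0) := by
  simpa using (tendsto_pow_atTop_nhds_zero_of_lt_one (sub_nonneg.mpr hκ1)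
    (sub_lt_self 1 hκ0)).mul_const b

theorem continuousOn_clearingVec (ha : ∀ i, 0 < a i) (hℓ : ∀ i j, 0 ≤ ℓ i j) (i : Fin N) :
    ContinuousOn (fun b => clearingVec b ℓ i) (Ici a) := by
  obtain ⟨κ, hκ0, hκ1, hκ⟩ := exists_contraction_rate a (lbar ℓ) ha
  refine TendstoUniformlyOn.continuousOn (p := atTop)
    (F := fun n b => (Phi (relPi ℓ) b (lbar ℓ))^[n] 0 i) ?_
    (Frequently.of_forall fun n =>
      ((continuous_apply i).comp (continuous_iterate_Phi _ _ n)).continuousOn)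
  rw [Metric.tendstoUniformlyOn_iff]
  intro ε hε
  filter_upwards [(tendsto_pow_mul_zero hκ0 hκ1 (lbar ℓ i)).eventually_lt_const hε] with n hn b hb
  exact (abs_clearingVec_sub_iterate_le (fun i => (ha i).le.trans (hb i)) hℓ hκ0.le hκ1
    (fun i => (hκ i).trans (hb i)) n i).trans_lt hn

theorem continuousOn_aggLoss (ha : ∀ i, 0 < a i) (hℓ : ∀ i j, 0 ≤ ℓ i j) :
    ContinuousOn (fun b => aggLoss b ℓ) (Ici a) :=
  continuousOn_finsetSum _ fun i _ => continuousOn_const.sub (continuousOn_clearingVec ha hℓ i)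

theorem measurable_aggLoss {Ω : Type*} [MeasurableSpace Ω] {a : Ω → Fin N → ℝ}
    {ℓ : Ω → Fin N → Fin N → ℝ} (ha : Measurable a) (hℓ : Measurable ℓ)
    (hpos : ∀ ω i, 0 < a ω i) (hnn : ∀ ω i j, 0 ≤ ℓ ω i j) :
    Measurable fun ω => aggLoss (a ω) (ℓ ω) := by
  refine Finset.measurable_sum _ fun i _ => Measurable.sub
    (Finset.measurable_sum _ fun j _ => by fun_prop) ?_
  refine measurable_of_tendsto_metrizable
    (fun n => (measurable_pi_apply i).comp (measurable_iterate_Phi ha hℓ n))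
    (tendsto_pi_nhds.mpr fun ω => ?_)
  obtain ⟨κ, hκ0, hκ1, hκ⟩ := exists_contraction_rate (a ω) (lbar (ℓ ω)) (hpos ω)
  rw [tendsto_iff_dist_tendsto_zero]
  refine squeeze_zero (fun _ => dist_nonneg) (fun n => ?_)
    (tendsto_pow_mul_zero hκ0 hκ1 (lbar (ℓ ω) i))
  rw [dist_comm]
  exact abs_clearingVec_sub_iterate_le (fun i => (hpos ω i).le) (hnn ω) hκ0.le hκ1 hκ n i

theorem integrable_aggLoss {Ω : Type*} [MeasurableSpace Ω] {P : Measure Ω}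
    {a : Ω → Fin N → ℝ} {ℓ : Ω → Fin N → Fin N → ℝ} (ha : Measurable a) (hℓ : Measurable ℓ)
    (hpos : ∀ ω i, 0 < a ω i) (hnn : ∀ ω i j, 0 ≤ ℓ ω i j)
    (hint : Integrable (fun ω => ∑ i, ∑ j, ℓ ω i j) P) :
    Integrable (fun ω => aggLoss (a ω) (ℓ ω)) P :=
  hint.mono' (measurable_aggLoss ha hℓ hpos hnn).aestronglyMeasurable <| .of_forall fun ω => by
    rw [Real.norm_of_nonneg (aggLoss_nonneg (fun i => (hpos ω i).le) (hnn ω))]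
    exact aggLoss_le (fun i => (hpos ω i).le) (hnn ω)

end Clearing

theorem isCompact_nonneg_sum_eq (N : ℕ) (c : ℝ) :
    IsCompact {y : Fin N → ℝ | (∀ i, 0 ≤ y i) ∧ ∑ i, y i = c} := by
  refine (isCompact_Icc (a := (0 : Fin N → ℝ)) (b := fun _ => c)).of_isClosed_subset ?_ ?_
  · exact (isClosed_Ici (a := (0 : Fin N → ℝ))).inter
      (isClosed_eq (continuous_finsetSum _ fun i _ => continuous_apply i) continuous_const)
  · rintro y ⟨hy0, hyc⟩
    exact ⟨hy0, fun i => hyc ▸ Finset.single_le_sum (fun j _ => hy0 j) (Finset.mem_univ i)⟩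

/-- For every capital level `c ≥ 0` the infimum defining the inner risk
`ρ^I_c(A, L)` is attained by some allocation `Y ∈ 𝒞^c`. -/
theorem innerRisk_attained
    {Ω : Type*} [MeasurableSpace Ω] (P : Measure Ω) [IsProbabilityMeasure P]
    (N : ℕ) (hN : 1 ≤ N)
    (η : (Ω → ℝ) → ℝ)
    (hη_mono : ∀ X Y : Ω → ℝ, Integrable X P → Integrable Y P →
      (∀ᵐ ω ∂P, X ω ≤ Y ω) → η X ≤ η Y)
    (hη_conv : ∀ X Y : Ω → ℝ, Integrable X P → Integrable Y P → ∀ t : ℝ, 0 ≤ t → t ≤ 1 →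
      η (fun ω => t * X ω + (1 - t) * Y ω) ≤ t * η X + (1 - t) * η Y)
    (hη_norm : η (fun _ => 0) = 0)
    (hη_cont : ∀ ε : ℝ, 0 < ε → ∃ δ : ℝ, 0 < δ ∧ ∀ X Y : Ω → ℝ,
      Integrable X P → Integrable Y P → (∫ ω, |X ω - Y ω| ∂P) < δ → |η X - η Y| < ε)
    (A : Ω → Fin N → ℝ) (hA : Measurable A) (hApos : ∀ ω i, 0 < A ω i)
    (L : Ω → Fin N → Fin N → ℝ) (hL : Measurable L)
    (hLnn : ∀ ω i j, 0 ≤ L ω i j) (hLdiag : ∀ ω i, L ω i i = 0)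
    (hLint : Integrable (fun ω => ∑ i, ∑ j, L ω i j) P)
    (c : ℝ) (hc : 0 ≤ c) :
    ∃ Y : Ω → Fin N → ℝ, Measurable Y ∧ (∀ ω i, 0 ≤ Y ω i) ∧
      (∀ᵐ ω ∂P, ∑ i, Y ω i = c) ∧
      η (fun ω => aggLoss (fun i => A ω i + Y ω i) (L ω)) = innerRisk P η A L c := by
  let K : Set (Fin N → ℝ) := {y | (∀ i, 0 ≤ y i) ∧ ∑ i, y i = c}
  have : CompactSpace K := isCompact_iff_compactSpace.mp (isCompact_nonneg_sum_eq N c)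
  have : Nonempty K :=
    ⟨⟨Pi.single ⟨0, hN⟩ c,
      fun i => (Pi.single_nonneg (α := fun _ : Fin N => ℝ)).mpr hc i,
      by simp⟩⟩
  have hpos : ∀ Y : Ω → Fin N → ℝ, (∀ ω i, 0 ≤ Y ω i) → ∀ ω i, 0 < A ω i + Y ω i :=
    fun Y hY ω i => add_pos_of_pos_of_nonneg (hApos ω i) (hY ω i)
  have hint : ∀ Y : Ω → Fin N → ℝ, Measurable Y → (∀ ω i, 0 ≤ Y ω i) →
      Integrable (fun ω => aggLoss (fun i => A ω i + Y ω i) (L ω)) P := fun Y hYm hY0 =>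
    integrable_aggLoss (hA.add hYm) hL (hpos Y hY0) hLnn hLint
  obtain ⟨Y, hYm, hYmin⟩ := exists_measurable_argmin
    (fun ω (y : K) => aggLoss (fun i => A ω i + y.1 i) (L ω))
    (fun y => measurable_aggLoss (hA.add measurable_const) hL (hpos (fun _ => y) fun _ => y.2.1)
      hLnn)
    (fun ω => (continuousOn_aggLoss (hApos ω) (hLnn ω)).comp_continuous
      (continuous_const.add continuous_subtype_val)
      fun y i => le_add_of_nonneg_right (y.2.1 i))
  let Y' : Ω → Fin N → ℝ := fun ω => Y ω
  have hY'm : Measurable Y' := measurable_subtype_coe.comp hYm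
  have hY'0 : ∀ ω i, 0 ≤ Y' ω i := fun ω => (Y ω).2.1
  have hY'c : ∀ᵐ ω ∂P, ∑ i, Y' ω i = c := .of_forall fun ω => (Y ω).2.2
  refine ⟨Y', hY'm, hY'0, hY'c, Eq.symm ?_⟩
  apply IsLeast.csInf_eq
  refine ⟨⟨Y', hY'm, hY'0, hY'c, rfl⟩, ?_⟩
  rintro _ ⟨Z, hZm, hZ0, hZc, rfl⟩
  refine hη_mono _ _ (hint Y' hY'm hY'0) (hint Z hZm hZ0) ?_
  filter_upwards [hZc] with ω hω
  exact hYmin ω ⟨Z ω, hZ0 ω, hω⟩
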